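/- Let (X,d) be a complete separable metric space, p ≥ 1, x̄ ∈ X, and let 𝔏 ∈ P(P(C([0,T],X))) satisfy ∫∫ (d^p(x̄, γ(0)) + ∫₀ᵀ|γ̇|ᵖ(t)dt) dλ(γ) d𝔏(λ) < ∞ (each inner λ being concentrated on absolutely continuous curves). Define M_t := (E_t)_♯ 𝔏 where E_t(λ) = (e_t)_♯λ. Then M = (M_t)_{t∈[0,T]} belongs to AC^p([0,T], P_p(P_p(X))) with respect to the Wasserstein-on-Wasserstein metric W_{p,W_p}, and for a.e. t, |Ṁ|^p(t) ≤ ∫∫ |γ̇|ᵖ(t) dλ(γ) d𝔏(λ). -/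

import Mathlib

open MeasureTheory Set ENNReal Filter

noncomputable section

/-- The set of couplings between two measures. -/
def couplings {α : Type*} [MeasurableSpace α] (μ ν : Measure α) : Set (Measure (α × α)) :=
  {π | π.map Prod.fst = μ ∧ π.map Prod.snd = ν}

/-- The `p`-th power of the `p`-Wasserstein distance. -/
def Wpp {α : Type*} [MeasurableSpace α] [PseudoEMetricSpace α] (p : ℝ)
    (μ ν : Measure α) : ℝ≥0∞ :=
  ⨅ π ∈ couplings μ ν, ∫⁻ z : α × α, edist z.1 z.2 ^ p ∂π

/-- The `p`-th power of the Wasserstein-on-Wasserstein distance `𝒲_p = W_{p,W_p}`. -/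
def WWpp {α : Type*} [MeasurableSpace α] [PseudoEMetricSpace α] (p : ℝ)
    (M N : Measure (Measure α)) : ℝ≥0∞ :=
  ⨅ Pl ∈ couplings M N, ∫⁻ q : Measure α × Measure α, Wpp p q.1 q.2 ∂Pl

/-- Extension of a curve `γ : [0,T] → X` to `ℝ` by clamping. -/
def extendIcc {X : Type*} [TopologicalSpace X] {T : ℝ} (hT : 0 ≤ T)
    (γ : C(Icc (0:ℝ) T, X)) : ℝ → X := fun r => γ (projIcc 0 T hT r)

/-- The metric derivative `|γ̇|(t)` of a curve. -/
def mSpeed {X : Type*} [PseudoMetricSpace X] (γ : ℝ → X) (t : ℝ) : ℝ :=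
  limUnder (nhdsWithin t {t}ᶜ) (fun s => dist (γ s) (γ t) / |s - t|)

/-- The `p`-th power `|Ṁ|^p(t)` of the metric derivative of a curve of random measures
with respect to the Wasserstein-on-Wasserstein distance. -/
def pSpeedWW {X : Type*} [MeasurableSpace X] [PseudoEMetricSpace X] (p : ℝ)
    (M : ℝ → Measure (Measure X)) (t : ℝ) : ℝ≥0∞ :=
  limUnder (nhdsWithin t {t}ᶜ) (fun s => WWpp p (M s) (M t) / ENNReal.ofReal (|s - t| ^ p))

/-- `γ` is an absolutely continuous curve on `[0,T]`. -/
def IsACOn {X : Type*} [PseudoMetricSpace X] (T : ℝ) (γ : ℝ → X) : Prop :=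
  ∃ g : ℝ → ℝ, (∀ r, 0 ≤ g r) ∧
    (∫⁻ r in Icc 0 T, ENNReal.ofReal (g r)) < ⊤ ∧
    ∀ ⦃s t : ℝ⦄, s ∈ Icc 0 T → t ∈ Icc 0 T → s ≤ t →
      dist (γ s) (γ t) ≤ ∫ r in Icc s t, g r

section Gluing

open ProbabilityTheory

/-- Gluing of two measures with a common marginal.  The last space need not be standard Borel: it
is enough that it is, almost everywhere, a measurable retract of a standard Borel space. -/
theorem exists_glue {A B C S : Type*} [MeasurableSpace A] [MeasurableSpace B] [MeasurableSpace C]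
    [MeasurableSpace S] [StandardBorelSpace S] [Nonempty S]
    (π₁ : Measure (A × B)) (π₂ : Measure (B × C)) [IsFiniteMeasure π₁] [IsFiniteMeasure π₂]
    (h : π₁.map Prod.snd = π₂.map Prod.fst) {ι : C → S} {R : S → C} (hι : Measurable ι)
    (hR : Measurable R) (hRι : ∀ᵐ z ∂π₂, R (ι z.2) = z.2) :
    ∃ Ω : Measure ((A × B) × C), Ω.map Prod.fst = π₁ ∧
      Ω.map (fun z => (z.1.2, z.2)) = π₂ := by
  set ρ := π₂.map (Prod.map id ι) with hρ
  have hm : Measurable (Prod.map (id : B → B) ι) := by fun_prop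
  have hmR : Measurable (Prod.map (id : B → B) R) := by fun_prop
  have hfst : ρ.fst = π₁.map Prod.snd := by
    rw [hρ, Measure.fst, Measure.map_map measurable_fst hm, h]; rfl
  set κ := ρ.condKernel.map R
  have : IsMarkovKernel κ := Kernel.IsMarkovKernel.map _ hR
  refine ⟨π₁ ⊗ₘ (κ.comap Prod.snd measurable_snd), Measure.fst_compProd _ _, ?_⟩
  have hκ : (π₁.map Prod.snd) ⊗ₘ κ = π₂ := by
    rw [← hfst, Measure.compProd_map hR, Measure.disintegrate, hρ, Measure.map_map hmR hm]
    conv_rhs => rw [← Measure.map_id (μ := π₂)]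
    refine Measure.map_congr ?_
    filter_upwards [hRι] with z hz
    simp [Prod.ext_iff, hz]
  rw [← hκ]
  have hm' : Measurable (fun z : (A × B) × C => (z.1.2, z.2)) := by fun_prop
  refine Measure.ext_of_lintegral _ fun f hf => ?_
  rw [lintegral_map hf hm',
    Measure.lintegral_compProd (f := fun z : (A × B) × C => f (z.1.2, z.2)) (hf.comp hm'),
    Measure.lintegral_compProd hf, lintegral_map hf.lintegral_kernel_prod_right' measurable_snd]
  rfl

/-- Probability measures on a standard Borel space form a measurable retract of the standard
Borel space `ℚ → ℝ`. -/
theorem exists_measurable_retract {X : Type*} [MeasurableSpace X] [StandardBorelSpace X]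
    [Nonempty X] : ∃ (ι : Measure X → ℚ → ℝ) (R : (ℚ → ℝ) → Measure X), Measurable ι ∧
      Measurable R ∧ ∀ μ : Measure X, IsProbabilityMeasure μ → R (ι μ) = μ := by
  have he := measurableEmbedding_embeddingReal X
  obtain ⟨g, hg, hge⟩ := he.exists_measurable_extend measurable_id (fun _ => ‹Nonempty X›)
  let F : (ℚ → ℝ) → Measure ℝ := fun f =>
    (stieltjesOfMeasurableRat (id : (ℚ → ℝ) → ℚ → ℝ) measurable_id f).measure
  have hF : Measurable F :=
    IsMeasurableRatCDF.measurable_measure_stieltjesFunction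
      (isMeasurableRatCDF_toRatCDF measurable_id)
  refine ⟨fun μ q => (μ.map (embeddingReal X) (Iic (q : ℝ))).toReal, fun f => (F f).map g, ?_,
    (Measure.measurable_map g hg).comp hF, ?_⟩
  · refine measurable_pi_lambda _ fun q => ENNReal.measurable_toReal.comp ?_
    exact (Measure.measurable_coe measurableSet_Iic).comp (Measure.measurable_map _ he.measurable)
  · intro μ hμ
    set ν := μ.map (embeddingReal X) with hν
    have : IsProbabilityMeasure ν := Measure.isProbabilityMeasure_map he.measurable.aemeasurable
    have hcdf : (fun q : ℚ => (ν (Iic (q : ℝ))).toReal) = fun q : ℚ => cdf ν q := by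
      ext q; rw [cdf_eq_real]; rfl
    have hpt : IsRatStieltjesPoint (id : (ℚ → ℝ) → ℚ → ℝ) (fun q : ℚ => cdf ν q) := by
      refine ⟨fun a b hab => monotone_cdf ν (by exact_mod_cast hab),
        (tendsto_cdf_atTop ν).comp (tendsto_ratCast_atTop_iff.2 tendsto_id),
        (tendsto_cdf_atBot ν).comp (tendsto_ratCast_atBot_iff.2 tendsto_id), fun t => ?_⟩
      rw [id, ← StieltjesFunction.iInf_rat_gt_eq (cdf ν) t]
      refine Equiv.iInf_congr
        { toFun := fun r => ⟨r.1, by exact_mod_cast r.2⟩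
          invFun := fun r => ⟨r.1, by exact_mod_cast r.2⟩
          left_inv := fun _ => rfl
          right_inv := fun _ => rfl } fun r => rfl
    have hFν : F (fun q : ℚ => (ν (Iic (q : ℝ))).toReal) = ν := by
      rw [hcdf]
      conv_rhs => rw [← measure_cdf ν]
      simp only [F]
      congr 1
      ext x
      rw [← StieltjesFunction.iInf_rat_gt_eq, ← StieltjesFunction.iInf_rat_gt_eq (cdf ν) x]
      refine iInf_congr fun r => ?_
      rw [stieltjesOfMeasurableRat_eq, toRatCDF_of_isRatStieltjesPoint hpt]
      rfl
    simp only
    rw [hFν, hν, Measure.map_map hg he.measurable, hge, Measure.map_id]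

end Gluing

section OptimalTransport

/-- The optimal transport cost associated with the cost function `C`. -/
def otCost {α : Type*} [MeasurableSpace α] (C : α → α → ℝ≥0∞) (μ ν : Measure α) : ℝ≥0∞ :=
  ⨅ π ∈ couplings μ ν, ∫⁻ z : α × α, C z.1 z.2 ∂π

variable {α : Type*} [MeasurableSpace α]

theorem otCost_le {C : α → α → ℝ≥0∞} {μ ν : Measure α} {π : Measure (α × α)}
    (hπ : π ∈ couplings μ ν) : otCost C μ ν ≤ ∫⁻ z : α × α, C z.1 z.2 ∂π :=
  iInf₂_le π hπ

theorem otCost_map_le {Ω : Type*} [MeasurableSpace Ω] (C : α → α → ℝ≥0∞) (P : Measure Ω)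
    {f g : Ω → α} (hf : Measurable f) (hg : Measurable g) :
    otCost C (P.map f) (P.map g) ≤ ∫⁻ ω, C (f ω) (g ω) ∂P := by
  refine (otCost_le (π := P.map fun ω => (f ω, g ω)) ⟨?_, ?_⟩).trans (lintegral_map_le _ _)
  · rw [Measure.map_map measurable_fst (by fun_prop)]; rfl
  · rw [Measure.map_map measurable_snd (by fun_prop)]; rfl

theorem otCost_comm {C : α → α → ℝ≥0∞} (hC : ∀ a b, C a b = C b a) (μ ν : Measure α) :
    otCost C μ ν = otCost C ν μ := by
  have key : ∀ μ ν : Measure α, otCost C μ ν ≤ otCost C ν μ := by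
    intro μ ν
    refine le_iInf₂ fun π hπ => ?_
    refine (otCost_le (π := π.map MeasurableEquiv.prodComm) ⟨?_, ?_⟩).trans ?_
    · rw [Measure.map_map measurable_fst (MeasurableEquiv.measurable _), ← hπ.2]; rfl
    · rw [Measure.map_map measurable_snd (MeasurableEquiv.measurable _), ← hπ.1]; rfl
    · rw [lintegral_map_equiv]
      exact (lintegral_congr fun z => hC _ _).le
  exact le_antisymm (key μ ν) (key ν μ)

theorem otCost_triangle {S : Type*} [MeasurableSpace S] [StandardBorelSpace S] [Nonempty S]
    {ι : α → S} {R : S → α} (hι : Measurable ι) (hR : Measurable R)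
    {p : ℝ} (hp : 1 ≤ p) {P : α → Prop} (hRι : ∀ a, P a → R (ι a) = a)
    {C : α → α → ℝ≥0∞} {C' : α × α → ℝ≥0∞} (hC'm : Measurable C')
    (hC' : ∀ a b, P a → P b → C a b = C' (a, b))
    (htri : ∀ a b c, P a → P b → P c → C a c ^ (1 / p) ≤ C a b ^ (1 / p) + C b c ^ (1 / p))
    {μ₁ μ₂ μ₃ : Measure α} [IsFiniteMeasure μ₁] [IsFiniteMeasure μ₃]
    (h₁ : ∀ᵐ a ∂μ₁, P a) (h₂ : ∀ᵐ a ∂μ₂, P a) (h₃ : ∀ᵐ a ∂μ₃, P a) :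
    otCost C μ₁ μ₃ ^ (1 / p) ≤ otCost C μ₁ μ₂ ^ (1 / p) + otCost C μ₂ μ₃ ^ (1 / p) := by
  have hp0 : 0 < p := by linarith
  have hip : 0 < 1 / p := by positivity
  have inf_rpow : ∀ μ ν : Measure α, otCost C μ ν ^ (1 / p) =
      ⨅ π : couplings μ ν, (∫⁻ z : α × α, C z.1 z.2 ∂π.1) ^ (1 / p) := by
    intro μ ν
    rw [otCost, iInf_subtype']
    exact (ENNReal.orderIsoRpow (1 / p) hip).map_iInf _
  rw [inf_rpow μ₁ μ₂, inf_rpow μ₂ μ₃, ENNReal.iInf_add]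
  refine le_iInf fun π₁ => ?_
  rw [ENNReal.add_iInf]
  refine le_iInf fun π₂ => ?_
  obtain ⟨π₁, hπ₁, hπ₁'⟩ := π₁
  obtain ⟨π₂, hπ₂, hπ₂'⟩ := π₂
  have fin₁ : IsFiniteMeasure π₁ := by
    have : IsFiniteMeasure (π₁.map Prod.fst) := by rw [hπ₁]; infer_instance
    exact Measure.isFiniteMeasure_of_map measurable_fst.aemeasurable
  have fin₂ : IsFiniteMeasure π₂ := by
    have : IsFiniteMeasure (π₂.map Prod.snd) := by rw [hπ₂']; infer_instance
    exact Measure.isFiniteMeasure_of_map measurable_snd.aemeasurable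
  have hae : ∀ᵐ z ∂π₂, R (ι z.2) = z.2 := by
    rw [← hπ₂'] at h₃
    filter_upwards [ae_of_ae_map measurable_snd.aemeasurable h₃] with z hz using hRι _ hz
  obtain ⟨Ω, hΩ₁, hΩ₂⟩ := exists_glue π₁ π₂ (hπ₁'.trans hπ₂.symm) hι hR hae
  have m12 : Measurable (fun z : (α × α) × α => z.1) := measurable_fst
  have m23 : Measurable (fun z : (α × α) × α => (z.1.2, z.2)) := by fun_prop
  have e1 : Ω.map (fun z => z.1.1) = μ₁ := by
    rw [← hπ₁, ← hΩ₁, Measure.map_map measurable_fst measurable_fst]; rfl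
  have e2 : Ω.map (fun z => z.1.2) = μ₂ := by
    rw [← hπ₁', ← hΩ₁, Measure.map_map measurable_snd measurable_fst]; rfl
  have e3 : Ω.map (fun z => z.2) = μ₃ := by
    rw [← hπ₂', ← hΩ₂, Measure.map_map measurable_snd m23]; rfl
  have a1 : ∀ᵐ z ∂Ω, P z.1.1 := by
    rw [← e1] at h₁; exact ae_of_ae_map (by fun_prop) h₁
  have a2 : ∀ᵐ z ∂Ω, P z.1.2 := by
    rw [← e2] at h₂; exact ae_of_ae_map (by fun_prop) h₂
  have a3 : ∀ᵐ z ∂Ω, P z.2 := by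
    rw [← e3] at h₃; exact ae_of_ae_map (by fun_prop) h₃
  have cong : ∀ {π : Measure (α × α)}, (∀ᵐ z ∂π, P z.1) → (∀ᵐ z ∂π, P z.2) →
      ∫⁻ z, C z.1 z.2 ∂π = ∫⁻ z, C' z ∂π := fun hz₁ hz₂ => by
    refine lintegral_congr_ae ?_
    filter_upwards [hz₁, hz₂] with z u v using hC' _ _ u v
  have i12 : ∫⁻ z, C z.1 z.2 ∂π₁ = ∫⁻ z, C' z.1 ∂Ω := by
    rw [← lintegral_map hC'm m12, hΩ₁]
    rw [← hπ₁] at h₁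
    rw [← hπ₁'] at h₂
    exact cong (ae_of_ae_map measurable_fst.aemeasurable h₁)
      (ae_of_ae_map measurable_snd.aemeasurable h₂)
  have i23 : ∫⁻ z, C z.1 z.2 ∂π₂ = ∫⁻ z, C' (z.1.2, z.2) ∂Ω := by
    rw [← lintegral_map hC'm m23, hΩ₂]
    rw [← hπ₂] at h₂
    rw [← hπ₂'] at h₃
    exact cong (ae_of_ae_map measurable_fst.aemeasurable h₂)
      (ae_of_ae_map measurable_snd.aemeasurable h₃)
  have hpow : ∀ x : ℝ≥0∞, (x ^ (1 / p)) ^ p = x := fun x => by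
    rw [← ENNReal.rpow_mul, one_div_mul_cancel hp0.ne', ENNReal.rpow_one]
  have main : ∫⁻ z, C z.1.1 z.2 ∂Ω ≤
      ∫⁻ z, ((fun z : (α × α) × α => C' z.1 ^ (1 / p)) +
        fun z : (α × α) × α => C' (z.1.2, z.2) ^ (1 / p)) z ^ p ∂Ω := by
    refine lintegral_mono_ae ?_
    filter_upwards [a1, a2, a3] with z u v w
    rw [← hpow (C z.1.1 z.2)]
    refine ENNReal.rpow_le_rpow ?_ hp0.le
    simp only [Pi.add_apply]
    rw [← hC' z.1.2 z.2 v w, show z.1 = (z.1.1, z.1.2) from rfl, ← hC' z.1.1 z.1.2 u v]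
    exact htri _ _ _ u v w
  have mink := ENNReal.lintegral_Lp_add_le (μ := Ω) (p := p)
    (f := fun z : (α × α) × α => C' z.1 ^ (1 / p)) (g := fun z => C' (z.1.2, z.2) ^ (1 / p))
    ((hC'm.comp m12).pow_const _).aemeasurable ((hC'm.comp m23).pow_const _).aemeasurable hp
  simp only [hpow] at mink
  have hcost : otCost C μ₁ μ₃ ≤ ∫⁻ z, C z.1.1 z.2 ∂Ω := by
    rw [← e1, ← e3]
    exact otCost_map_le C Ω (by fun_prop) (by fun_prop)
  calc otCost C μ₁ μ₃ ^ (1 / p)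
      ≤ (∫⁻ z, C z.1.1 z.2 ∂Ω) ^ (1 / p) := ENNReal.rpow_le_rpow hcost hip.le
    _ ≤ _ := ENNReal.rpow_le_rpow main hip.le
    _ ≤ _ := mink
    _ = _ := by rw [i12, i23]

end OptimalTransport

section DiscreteTransport

/-- The optimal transport cost between two weight vectors on a finite set. -/
def discreteCost {I : Type*} [Fintype I] (c : I → I → ℝ≥0∞)
    (ab : (I → ℝ≥0∞) × (I → ℝ≥0∞)) : ℝ≥0∞ :=
  ⨅ m ∈ {m : I → I → ℝ≥0∞ | (∀ i, ∑ j, m i j = ab.1 i) ∧ ∀ j, ∑ i, m i j = ab.2 j},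
    ∑ i, ∑ j, m i j * c i j

theorem measurable_discreteCost {I : Type*} [Fintype I] {c : I → I → ℝ≥0∞}
    (hc : ∀ i j, c i j ≠ ⊤) : Measurable (discreteCost c) := by
  refine measurable_of_Iio fun b => ?_
  let K : ℝ≥0∞ → Set (((I → ℝ≥0∞) × (I → ℝ≥0∞)) × (I → I → ℝ≥0∞)) := fun q =>
    {z | ((∀ i, ∑ j, z.2 i j = z.1.1 i) ∧ ∀ j, ∑ i, z.2 i j = z.1.2 j) ∧
      ∑ i, ∑ j, z.2 i j * c i j ≤ q}
  have hK : ∀ q, IsClosed (K q) := by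
    intro q
    have h1 : IsClosed {z : ((I → ℝ≥0∞) × (I → ℝ≥0∞)) × (I → I → ℝ≥0∞) |
        ∀ i, ∑ j, z.2 i j = z.1.1 i} := by
      simp only [Set.ofPred_forall]
      exact isClosed_iInter fun i => isClosed_eq (by fun_prop) (by fun_prop)
    have h2 : IsClosed {z : ((I → ℝ≥0∞) × (I → ℝ≥0∞)) × (I → I → ℝ≥0∞) |
        ∀ j, ∑ i, z.2 i j = z.1.2 j} := by
      simp only [Set.ofPred_forall]
      exact isClosed_iInter fun i => isClosed_eq (by fun_prop) (by fun_prop)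
    have h3 : IsClosed {z : ((I → ℝ≥0∞) × (I → ℝ≥0∞)) × (I → I → ℝ≥0∞) |
        ∑ i, ∑ j, z.2 i j * c i j ≤ q} := by
      refine isClosed_le ?_ continuous_const
      refine continuous_finsetSum _ fun i _ => continuous_finsetSum _ fun j _ => ?_
      exact (ENNReal.continuous_mul_const (hc i j)).comp (by fun_prop)
    exact (h1.inter h2).inter h3
  have himg : discreteCost c ⁻¹' Iio b =
      ⋃ q : ℚ, ⋃ _ : (((q : ℝ).toNNReal : ℝ≥0∞) < b), Prod.fst '' K (q : ℝ).toNNReal := by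
    ext z
    simp only [mem_preimage, mem_Iio, discreteCost, iInf_lt_iff, mem_iUnion, mem_image]
    constructor
    · rintro ⟨m, hm, hlt⟩
      obtain ⟨q, -, h1, h2⟩ := ENNReal.lt_iff_exists_rat_btwn.1 hlt
      exact ⟨q, h2, (z, m), ⟨hm, h1.le⟩, rfl⟩
    · rintro ⟨q, hq, ⟨z', m⟩, ⟨hm, hle⟩, rfl⟩
      exact ⟨m, hm, lt_of_le_of_lt hle hq⟩
  rw [himg]
  exact MeasurableSet.iUnion fun q => MeasurableSet.iUnion fun _ =>
    (isClosedMap_fst_of_compactSpace _ (hK _)).measurableSet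

theorem lintegral_map_simpleFunc {X Y : Type*} [MeasurableSpace X] [MeasurableSpace Y]
    (T : SimpleFunc X Y) (μ : Measure X) {f : Y → ℝ≥0∞} (hf : Measurable f) :
    ∫⁻ y, f y ∂(μ.map T) = ∑ i : T.range, f i * μ (T ⁻¹' {i.1}) := by
  rw [lintegral_map hf T.measurable, Finset.sum_coe_sort T.range fun i => f i * μ (T ⁻¹' {i}),
    ← SimpleFunc.map_lintegral, ← SimpleFunc.lintegral_eq_lintegral]
  rfl

theorem otCost_map_simpleFunc {X : Type*} [MeasurableSpace X] [MeasurableSingletonClass X]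
    (c : X → X → ℝ≥0∞) (T : SimpleFunc X X) (μ ν : Measure X) :
    otCost c (μ.map T) (ν.map T) =
      discreteCost (fun i j : T.range => c i j)
        (fun i => μ (T ⁻¹' {i.1}), fun j => ν (T ⁻¹' {j.1})) := by
  have hrange : ∀ ρ : Measure X, ρ.map T (T.range : Set X)ᶜ = 0 := fun ρ => by
    rw [Measure.map_apply T.measurable T.range.measurableSet.compl]
    convert measure_empty (μ := ρ)
    ext x
    simp
  refine le_antisymm (le_iInf₂ fun m hm => ?_) (le_iInf₂ fun π hπ => ?_)
  · let π : Measure (X × X) := ∑ i : T.range, ∑ j : T.range, m i j • Measure.dirac (i.1, j.1)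
    have hint : ∀ f : X × X → ℝ≥0∞, ∫⁻ z, f z ∂π = ∑ i, ∑ j, m i j * f (i.1, j.1) := by
      intro f
      simp only [π, lintegral_finsetSum_measure, lintegral_smul_measure, lintegral_dirac,
        smul_eq_mul]
    rw [← hint fun z => c z.1 z.2]
    refine otCost_le ⟨?_, ?_⟩
    · refine Measure.ext_of_lintegral _ fun f hf => ?_
      rw [lintegral_map hf measurable_fst, hint, lintegral_map_simpleFunc T μ hf]
      refine Finset.sum_congr rfl fun i _ => ?_
      simp only [← Finset.sum_mul, hm.1 i, mul_comm]
    · refine Measure.ext_of_lintegral _ fun f hf => ?_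
      rw [lintegral_map hf measurable_snd, hint, lintegral_map_simpleFunc T ν hf,
        Finset.sum_comm]
      refine Finset.sum_congr rfl fun j _ => ?_
      simp only [← Finset.sum_mul, hm.2 j, mul_comm]
  · have marg : ∀ {f g : X × X → X}, Measurable f → Measurable g → ∀ i : T.range,
        π (g ⁻¹' (T.range : Set X)ᶜ) = 0 →
        ∑ j : T.range, π (g ⁻¹' {j.1} ∩ f ⁻¹' {i.1}) = π (f ⁻¹' {i.1}) := by
      intro f g hf hg i h0
      have h1 := Finset.sum_coe_sort T.range fun j => π (g ⁻¹' {j} ∩ f ⁻¹' {i.1})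
      have h2 := sum_measure_preimage_singleton (μ := π.restrict (f ⁻¹' {i.1})) T.range
        fun y _ => hg (measurableSet_singleton y)
      simp only [Measure.restrict_apply (hg (measurableSet_singleton _))] at h2
      rw [h1, h2, Measure.restrict_apply (hg T.range.measurableSet), inter_comm]
      exact measure_inter_conull' (measure_mono_null (fun z hz => hz.2) h0)
    have hmem : (fun i j : T.range => π {(i.1, j.1)}) ∈
        {m : T.range → T.range → ℝ≥0∞ | (∀ i, ∑ j, m i j = μ (T ⁻¹' {i.1})) ∧
          ∀ j, ∑ i, m i j = ν (T ⁻¹' {j.1})} := by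
      refine ⟨fun i => ?_, fun j => ?_⟩
      · rw [← Measure.map_apply T.measurable (measurableSet_singleton _), ← hπ.1,
          Measure.map_apply measurable_fst (measurableSet_singleton _),
          ← marg measurable_fst measurable_snd i]
        · refine Finset.sum_congr rfl fun j _ => congrArg π ?_
          ext ⟨x, y⟩
          simp [and_comm]
        · rw [← Measure.map_apply measurable_snd T.range.measurableSet.compl, hπ.2, hrange]
      · rw [← Measure.map_apply T.measurable (measurableSet_singleton _), ← hπ.2,
          Measure.map_apply measurable_snd (measurableSet_singleton _),
          ← marg measurable_snd measurable_fst j]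
        · refine Finset.sum_congr rfl fun i _ => congrArg π ?_
          ext ⟨x, y⟩
          simp
        · rw [← Measure.map_apply measurable_fst T.range.measurableSet.compl, hπ.1, hrange]
    refine (iInf₂_le _ hmem).trans ?_
    calc ∑ i : T.range, ∑ j : T.range, π {(i.1, j.1)} * c i j
        = ∑ i ∈ T.range, ∑ j ∈ T.range, c i j * π {(i, j)} := by
          simp only [mul_comm (π _)]
          rw [← Finset.sum_coe_sort T.range]
          exact Finset.sum_congr rfl fun i _ =>
            Finset.sum_coe_sort T.range fun j => c i j * π {(i.1, j)}
      _ = ∫⁻ z in (T.range ×ˢ T.range : Finset (X × X)), c z.1 z.2 ∂π := by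
          rw [lintegral_finset, Finset.sum_product]
      _ ≤ _ := setLIntegral_le_lintegral _ _

end DiscreteTransport

section Wasserstein

theorem Wpp_comm {α : Type*} [MeasurableSpace α] [PseudoEMetricSpace α] (p : ℝ)
    (μ ν : Measure α) : Wpp p μ ν = Wpp p ν μ :=
  otCost_comm (C := fun a b : α => edist a b ^ p) (fun a b => by rw [edist_comm]) μ ν

variable {X : Type*} [MetricSpace X] [MeasurableSpace X]

/-- Probability measures with finite `p`-th moment. -/
def HasMoment (p : ℝ) (xb : X) (μ : Measure X) : Prop :=
  IsProbabilityMeasure μ ∧ ∫⁻ x, edist x xb ^ p ∂μ < ⊤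

theorem measurableSet_hasMoment [TopologicalSpace.SeparableSpace X] [BorelSpace X] (p : ℝ)
    (xb : X) : MeasurableSet {μ | HasMoment p xb μ} := by
  have h : {μ : Measure X | HasMoment p xb μ} =
      {μ | μ univ = 1} ∩ {μ | ∫⁻ x, edist x xb ^ p ∂μ < ⊤} := by
    ext μ
    simp [HasMoment, isProbabilityMeasure_iff]
  rw [h]
  exact (Measure.measurable_coe MeasurableSet.univ (measurableSet_singleton 1)).inter
    (measurableSet_lt (Measure.measurable_lintegral
      ((measurable_id.edist measurable_const).pow_const _)) measurable_const)

variable [CompleteSpace X] [TopologicalSpace.SeparableSpace X] [BorelSpace X]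

theorem Wpp_triangle {p : ℝ} (hp : 1 ≤ p) (μ₁ μ₂ μ₃ : Measure X) [IsFiniteMeasure μ₁]
    [IsFiniteMeasure μ₃] :
    Wpp p μ₁ μ₃ ^ (1 / p) ≤ Wpp p μ₁ μ₂ ^ (1 / p) + Wpp p μ₂ μ₃ ^ (1 / p) := by
  have := UniformSpace.secondCountable_of_separable X
  cases isEmpty_or_nonempty X
  · refine (ENNReal.rpow_le_rpow (otCost_le (C := fun a b : X => edist a b ^ p) (π := 0)
      ⟨?_, ?_⟩) (by positivity)).trans ?_
    · exact Measure.ext fun s _ => by simp [Subsingleton.elim s ∅]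
    · exact Measure.ext fun s _ => by simp [Subsingleton.elim s ∅]
    · have : (0 : ℝ) < p := by linarith
      simp [this]
  · refine otCost_triangle measurable_id measurable_id hp (P := fun _ => True)
      (C' := fun z => edist z.1 z.2 ^ p) (fun _ _ => rfl) (measurable_edist.pow_const _)
      (fun _ _ _ _ => rfl) (fun a b c _ _ _ => ?_) (by simp) (by simp) (by simp)
    have hp0 : p ≠ 0 := by linarith
    simp only [← ENNReal.rpow_mul, mul_one_div_cancel hp0, ENNReal.rpow_one]
    exact edist_triangle a b c

/-- On the set of probability measures with finite `p`-th moment, the Wasserstein distance agrees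
with a measurable function. -/
theorem exists_measurable_eq_Wpp {p : ℝ} (hp : 1 ≤ p) (xb : X) :
    ∃ C : Measure X × Measure X → ℝ≥0∞, Measurable C ∧
      ∀ μ ν, HasMoment p xb μ → HasMoment p xb ν → Wpp p μ ν = C (μ, ν) := by
  have hp0 : 0 < p := by linarith
  have hip : 0 < 1 / p := by positivity
  let T : ℕ → SimpleFunc X X := SimpleFunc.approxOn id measurable_id univ xb (mem_univ _)
  refine ⟨fun z => liminf (fun n => otCost (fun a b => edist a b ^ p) (z.1.map (T n))
    (z.2.map (T n))) atTop, ?_, fun μ ν hμ hν => ?_⟩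
  · refine Measurable.liminf fun n => ?_
    simp only [otCost_map_simpleFunc]
    refine (measurable_discreteCost fun i j => ?_).comp (Measurable.prodMk ?_ ?_)
    · exact (ENNReal.rpow_lt_top_of_nonneg hp0.le (edist_ne_top _ _)).ne
    · exact measurable_pi_lambda _ fun i =>
        (Measure.measurable_coe ((T n).measurableSet_fiber _)).comp measurable_fst
    · exact measurable_pi_lambda _ fun i =>
        (Measure.measurable_coe ((T n).measurableSet_fiber _)).comp measurable_snd
  · have hμ1 := hμ.1
    have hν1 := hν.1
    let e : Measure X → ℕ → ℝ≥0∞ := fun ρ n => (∫⁻ x, edist (T n x) x ^ p ∂ρ) ^ (1 / p)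
    have he : ∀ ρ, HasMoment p xb ρ → Tendsto (e ρ) atTop (nhds 0) := by
      intro ρ hρ
      have h0 : Tendsto (fun n => ∫⁻ x, edist (T n x) x ^ p ∂ρ) atTop (nhds (∫⁻ _, 0 ∂ρ)) := by
        refine tendsto_lintegral_of_dominated_convergence (fun x => edist x xb ^ p)
          (fun n => ?_) (fun n => ae_of_all _ fun x => ?_) hρ.2.ne (ae_of_all _ fun x => ?_)
        · exact ((T n).measurable.edist measurable_id).pow_const _
        · refine ENNReal.rpow_le_rpow ?_ hp0.le
          have := SimpleFunc.edist_approxOn_mono measurable_id (mem_univ xb) x (Nat.zero_le n)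
          rwa [SimpleFunc.approxOn_zero, edist_comm xb] at this
        · have h1 : Tendsto (fun n => edist (T n x) x) atTop (nhds 0) :=
            tendsto_iff_edist_tendsto_0.1
              (SimpleFunc.tendsto_approxOn measurable_id (mem_univ xb) (by simp))
          have h2 := (ENNReal.continuous_rpow_const (y := p)).tendsto 0 |>.comp h1
          rwa [ENNReal.zero_rpow_of_pos hp0] at h2
      have h2 := (ENNReal.continuous_rpow_const (y := 1 / p)).tendsto _ |>.comp h0
      rw [lintegral_zero, ENNReal.zero_rpow_of_pos hip] at h2
      exact h2
    have hle : ∀ (ρ : Measure X) n, Wpp p (ρ.map (T n)) ρ ^ (1 / p) ≤ e ρ n := fun ρ n => by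
      refine ENNReal.rpow_le_rpow ?_ hip.le
      have := otCost_map_le (fun a b : X => edist a b ^ p) ρ (T n).measurable measurable_id
      rwa [Measure.map_id] at this
    have hlim : Tendsto (fun n => Wpp p (μ.map (T n)) (ν.map (T n)) ^ (1 / p)) atTop
        (nhds (Wpp p μ ν ^ (1 / p))) := by
      have hs : Tendsto (fun n => e μ n + e ν n) atTop (nhds 0) := by
        simpa using (he μ hμ).add (he ν hν)
      have lo : Tendsto (fun n => Wpp p μ ν ^ (1 / p) - (e μ n + e ν n)) atTop
          (nhds (Wpp p μ ν ^ (1 / p))) := by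
        simpa using ENNReal.Tendsto.sub tendsto_const_nhds hs (Or.inr ENNReal.zero_ne_top)
      have up : Tendsto (fun n => Wpp p μ ν ^ (1 / p) + (e μ n + e ν n)) atTop
          (nhds (Wpp p μ ν ^ (1 / p))) := by
        simpa using hs.const_add (Wpp p μ ν ^ (1 / p))
      refine tendsto_of_tendsto_of_tendsto_of_le_of_le lo up (fun n => ?_) (fun n => ?_)
      · have h1 := Wpp_triangle hp μ (μ.map (T n)) ν
        have h2 := Wpp_triangle hp (μ.map (T n)) (ν.map (T n)) ν
        have h3 := hle μ n
        rw [Wpp_comm] at h3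
        refine tsub_le_iff_right.2 (h1.trans ?_)
        calc _ ≤ e μ n + (Wpp p (μ.map (T n)) (ν.map (T n)) ^ (1 / p) + e ν n) :=
              add_le_add h3 (h2.trans (by gcongr; exact hle ν n))
          _ = _ := by ring
      · have h1 := Wpp_triangle hp (μ.map (T n)) μ (ν.map (T n))
        have h2 := Wpp_triangle hp μ ν (ν.map (T n))
        have h3 := hle ν n
        rw [Wpp_comm] at h3
        refine h1.trans ?_
        calc _ ≤ e μ n + (Wpp p μ ν ^ (1 / p) + e ν n) :=
              add_le_add (hle μ n) (h2.trans (by gcongr))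
          _ = _ := by ring
    have h2 := (ENNReal.continuous_rpow_const (y := p)).tendsto _ |>.comp hlim
    simp only [Function.comp_def, ← ENNReal.rpow_mul, one_div_mul_cancel hp0.ne',
      ENNReal.rpow_one] at h2
    exact h2.liminf_eq.symm

theorem WWpp_comm {α : Type*} [MeasurableSpace α] [PseudoEMetricSpace α] (p : ℝ)
    (M N : Measure (Measure α)) : WWpp p M N = WWpp p N M :=
  otCost_comm (Wpp_comm p) M N

theorem WWpp_triangle {p : ℝ} (hp : 1 ≤ p) (xb : X) {M₁ M₂ M₃ : Measure (Measure X)}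
    [IsFiniteMeasure M₁] [IsFiniteMeasure M₃] (h₁ : ∀ᵐ μ ∂M₁, HasMoment p xb μ)
    (h₂ : ∀ᵐ μ ∂M₂, HasMoment p xb μ) (h₃ : ∀ᵐ μ ∂M₃, HasMoment p xb μ) :
    WWpp p M₁ M₃ ^ (1 / p) ≤ WWpp p M₁ M₂ ^ (1 / p) + WWpp p M₂ M₃ ^ (1 / p) := by
  have := UniformSpace.secondCountable_of_separable X
  have : Nonempty X := ⟨xb⟩
  obtain ⟨ι, R, hι, hR, hRι⟩ := exists_measurable_retract (X := X)
  obtain ⟨C, hCm, hC⟩ := exists_measurable_eq_Wpp hp xb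
  refine otCost_triangle hι hR hp (P := HasMoment p xb) (fun μ hμ => hRι μ hμ.1) hCm hC
    (fun μ ν ρ hμ hν hρ => ?_) h₁ h₂ h₃
  have := hμ.1
  have := hρ.1
  exact Wpp_triangle hp μ ν ρ

end Wasserstein

section MetricDerivative

theorem abs_sub_le_abs_intervalIntegral_sub {f g : ℝ → ℝ} (hg : Integrable g)
    (hf : ∀ s t, s ≤ t → |f s - f t| ≤ ∫ r in s..t, g r) (s t : ℝ) :
    |f s - f t| ≤ |(∫ r in (0 : ℝ)..s, g r) - ∫ r in (0 : ℝ)..t, g r| := by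
  rw [intervalIntegral.integral_interval_sub_left hg.intervalIntegrable hg.intervalIntegrable]
  rcases le_total s t with h | h
  · rw [intervalIntegral.integral_symm, abs_neg]
    exact (hf s t h).trans (le_abs_self _)
  · rw [abs_sub_comm]
    exact (hf t s h).trans (le_abs_self _)

theorem absolutelyContinuousOnInterval_of_le_integral {f g : ℝ → ℝ} (hg : Integrable g)
    (hf : ∀ s t, s ≤ t → |f s - f t| ≤ ∫ r in s..t, g r) (a b : ℝ) :
    AbsolutelyContinuousOnInterval f a b := by
  have hΦ : AbsolutelyContinuousOnInterval (fun x => ∫ r in (0 : ℝ)..x, g r) a b := by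
    have := (hg.intervalIntegrable (a := min 0 (min a b))
      (b := max 0 (max a b))).absolutelyContinuousOnInterval_intervalIntegral (c := 0) (by simp)
    refine this.mono (uIcc_subset_uIcc ?_ ?_) <;> simp
  exact squeeze_zero (fun E => Finset.sum_nonneg fun i _ => dist_nonneg)
    (fun E => Finset.sum_le_sum fun i _ => abs_sub_le_abs_intervalIntegral_sub hg hf _ _) hΦ

theorem ae_differentiableAt_of_le_integral {f g : ℝ → ℝ} (hg : Integrable g)
    (hf : ∀ s t, s ≤ t → |f s - f t| ≤ ∫ r in s..t, g r) :
    ∀ᵐ t, DifferentiableAt ℝ f t := by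
  have h : ∀ᵐ t : ℝ, ∀ n : ℕ, t ∈ uIcc (-(n : ℝ)) n → DifferentiableAt ℝ f t :=
    ae_all_iff.2 fun n =>
      (absolutelyContinuousOnInterval_of_le_integral hg hf _ _).ae_differentiableAt
  filter_upwards [h] with t ht
  obtain ⟨n, hn⟩ := exists_nat_ge |t|
  exact ht n (by rw [uIcc_of_le (by linarith [abs_nonneg t])]; exact abs_le.1 hn)

theorem tendsto_abs_div_abs_of_hasDerivAt {f : ℝ → ℝ} {f' t : ℝ} (h : HasDerivAt f f' t) :
    Tendsto (fun s => |f s - f t| / |s - t|) (nhdsWithin t {t}ᶜ) (nhds |f'|) := by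
  refine (h.tendsto_slope.abs).congr fun s => ?_
  rw [slope_def_field, abs_div]

theorem ae_abs_deriv_le_of_le_integral {f g : ℝ → ℝ} (hg : Integrable g)
    (hf : ∀ s t, s ≤ t → |f s - f t| ≤ ∫ r in s..t, g r) :
    ∀ᵐ t, |deriv f t| ≤ |g t| := by
  filter_upwards [ae_differentiableAt_of_le_integral hg hf,
    LocallyIntegrable.ae_hasDerivAt_integral hg.locallyIntegrable] with t h1 h2
  refine le_of_tendsto_of_tendsto' (tendsto_abs_div_abs_of_hasDerivAt h1.hasDerivAt)
    (tendsto_abs_div_abs_of_hasDerivAt (h2 0)) fun s => ?_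
  exact div_le_div_of_nonneg_right (abs_sub_le_abs_intervalIntegral_sub hg hf s t) (abs_nonneg _)

/-- Existence of the metric derivative of an absolutely continuous curve, formulated in terms of
the (pseudo)distance `d s t` between the points of the curve at times `s` and `t`. -/
theorem exists_metricDeriv {d : ℝ → ℝ → ℝ} (hself : ∀ s, d s s = 0)
    (hsymm : ∀ s t, d s t = d t s) (htri : ∀ r s t, d r t ≤ d r s + d s t) {g : ℝ → ℝ}
    (hg : Integrable g) (hg0 : ∀ r, 0 ≤ g r) (hd : ∀ s t, s ≤ t → d s t ≤ ∫ r in s..t, g r) :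
    ∃ m : ℝ → ℝ, Measurable m ∧ (∀ r, 0 ≤ m r) ∧ Integrable m ∧ (∀ᵐ r, m r ≤ g r) ∧
      (∀ s t, s ≤ t → d s t ≤ ∫ r in s..t, m r) ∧
      ∀ᵐ t, Tendsto (fun s => d s t / |s - t|) (nhdsWithin t {t}ᶜ) (nhds (m t)) := by
  have hφd : ∀ q s t, |d s q - d t q| ≤ d s t := fun q s t => by
    rw [abs_le]
    have h1 := htri s t q
    have h2 := htri t s q
    have h3 := hsymm s t
    constructor <;> linarith
  have hφ : ∀ q s t, s ≤ t → |d s q - d t q| ≤ ∫ r in s..t, g r := fun q s t hst =>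
    (hφd q s t).trans (hd s t hst)
  let m₀ : ℝ → ℝ≥0∞ := fun t => ⨆ q : ℚ, ‖deriv (fun s => d s q) t‖ₑ
  have hm₀ : Measurable m₀ := Measurable.iSup fun q => (measurable_deriv _).enorm
  let m : ℝ → ℝ := fun t => (m₀ t).toReal
  have hm : Measurable m := hm₀.ennreal_toReal
  have hm0 : ∀ r, 0 ≤ m r := fun r => ENNReal.toReal_nonneg
  have hm₀g : ∀ᵐ t, m₀ t ≤ ENNReal.ofReal (g t) := by
    filter_upwards [ae_all_iff.2 fun q : ℚ => ae_abs_deriv_le_of_le_integral hg (hφ q)] with t ht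
    refine iSup_le fun q => ?_
    rw [Real.enorm_eq_ofReal_abs, ← abs_of_nonneg (hg0 t)]
    exact ENNReal.ofReal_le_ofReal (ht q)
  have hmg : ∀ᵐ t, m t ≤ g t := by
    filter_upwards [hm₀g] with t ht using ENNReal.toReal_le_of_le_ofReal (hg0 t) ht
  have hmi : Integrable m := hg.mono' hm.aestronglyMeasurable <| by
    filter_upwards [hmg] with t ht
    rwa [Real.norm_of_nonneg (hm0 t)]
  have hφm : ∀ᵐ t, ∀ q : ℚ, |deriv (fun s => d s q) t| ≤ m t := by
    filter_upwards [hm₀g] with t ht q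
    rw [← Real.norm_eq_abs, ← toReal_enorm]
    exact ENNReal.toReal_mono (ne_top_of_le_ne_top ENNReal.ofReal_ne_top ht)
      (le_iSup (fun q : ℚ => ‖deriv (fun s => d s q) t‖ₑ) q)
  have hdm : ∀ s t, s ≤ t → d s t ≤ ∫ r in s..t, m r := by
    intro s t hst
    let Φ : ℝ → ℝ := fun x => ∫ r in (0 : ℝ)..x, g r
    have hΦc : Continuous Φ := intervalIntegral.continuous_primitive
      (fun a b => hg.intervalIntegrable) 0
    have hq : ∀ q : ℚ, d s t ≤ (∫ r in s..t, m r) + 2 * |Φ s - Φ q| := by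
      intro q
      have h1 := (absolutelyContinuousOnInterval_of_le_integral hg (hφ q) s t)
      have h2 : ∫ r in s..t, deriv (fun s => d s q) r ≤ ∫ r in s..t, m r := by
        refine intervalIntegral.integral_mono_ae hst h1.intervalIntegrable_deriv
          hmi.intervalIntegrable ?_
        filter_upwards [hφm] with r hr using (le_abs_self _).trans (hr q)
      rw [h1.integral_deriv_eq_sub] at h2
      have h3 : d s q ≤ |Φ s - Φ q| := by
        have := abs_sub_le_abs_intervalIntegral_sub hg (hφ q) s q
        rw [hself, sub_zero] at this
        exact (le_abs_self _).trans this
      have h4 := htri s q t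
      have h5 := hsymm q t
      linarith
    have hs := Rat.denseRange_cast (𝕜 := ℝ) |>.induction_on
      (p := fun x => d s t ≤ (∫ r in s..t, m r) + 2 * |Φ s - Φ x|) s
      (isClosed_le (by fun_prop) (by fun_prop)) hq
    simpa using hs
  refine ⟨m, hm, hm0, hmi, hmg, hdm, ?_⟩
  filter_upwards [hm₀g, LocallyIntegrable.ae_hasDerivAt_integral hmi.locallyIntegrable,
    ae_all_iff.2 fun q : ℚ => ae_differentiableAt_of_le_integral hg (hφ q)] with t h1 h2 h3
  have hfin : m₀ t ≠ ⊤ := ne_top_of_le_ne_top ENNReal.ofReal_ne_top h1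
  refine tendsto_order.2 ⟨fun a ha => ?_, fun a ha => ?_⟩
  · rcases lt_or_ge a 0 with ha0 | ha0
    · refine Eventually.of_forall fun s => lt_of_lt_of_le ha0 ?_
      have := (abs_nonneg _).trans (hφd 0 s t)
      positivity
    · have : ENNReal.ofReal a < m₀ t := (ENNReal.ofReal_lt_iff_lt_toReal ha0 hfin).2 ha
      obtain ⟨q, hq⟩ := lt_iSup_iff.1 this
      rw [ENNReal.ofReal_lt_iff_lt_toReal ha0 enorm_ne_top, toReal_enorm, Real.norm_eq_abs] at hq
      filter_upwards [(tendsto_abs_div_abs_of_hasDerivAt (h3 q).hasDerivAt).eventually_const_lt hq]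
        with s hs
      refine hs.trans_le ?_
      gcongr
      exact hφd q s t
  · have h4 := tendsto_abs_div_abs_of_hasDerivAt (h2 0)
    rw [abs_of_nonneg (hm0 t)] at h4
    filter_upwards [h4.eventually_lt_const ha] with s hs
    refine lt_of_le_of_lt ?_ hs
    gcongr
    have := abs_sub_le_abs_intervalIntegral_sub (f := fun s => d s t) hmi
      (fun s u hsu => (hφd t s u).trans (hdm s u hsu)) s t
    rw [hself, sub_zero] at this
    exact (le_abs_self _).trans this

end MetricDerivative

section Minkowski

/-- Minkowski's integral inequality. -/
theorem lintegral_lintegral_rpow_le {Ω S : Type*} [MeasurableSpace Ω] [MeasurableSpace S]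
    {η : Measure Ω} {ρ : Measure S} [SFinite η] [SFinite ρ] {v : Ω → S → ℝ≥0∞}
    (hv : Measurable (Function.uncurry v)) {p : ℝ} (hp : 1 ≤ p)
    (hfin : ∫⁻ ω, (∫⁻ r, v ω r ∂ρ) ^ p ∂η < ⊤) :
    ∫⁻ ω, (∫⁻ r, v ω r ∂ρ) ^ p ∂η ≤ (∫⁻ r, (∫⁻ ω, v ω r ^ p ∂η) ^ (1 / p) ∂ρ) ^ p := by
  have hp0 : 0 < p := by linarith
  rcases hp.eq_or_lt with rfl | hp1
  · simp only [ENNReal.rpow_one, div_one]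
    rw [lintegral_lintegral_swap hv.aemeasurable]
  set f : Ω → ℝ≥0∞ := fun ω => ∫⁻ r, v ω r ∂ρ with hf
  set I := ∫⁻ ω, f ω ^ p ∂η with hI
  have hfm : Measurable f := hv.lintegral_prod_right'
  have hpq := Real.HolderConjugate.conjExponent hp1
  set q := p.conjExponent
  have key : I ≤ (∫⁻ r, (∫⁻ ω, v ω r ^ p ∂η) ^ (1 / p) ∂ρ) * I ^ (1 / q) := by
    calc I = ∫⁻ ω, ∫⁻ r, v ω r * f ω ^ (p - 1) ∂ρ ∂η := by
          refine lintegral_congr fun ω => ?_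
          rw [lintegral_mul_const _ (hv.of_uncurry_left), ← congrFun hf ω]
          conv_lhs => rw [show p = 1 + (p - 1) by ring,
            ENNReal.rpow_add_of_nonneg _ _ zero_le_one (by linarith), ENNReal.rpow_one]
      _ = ∫⁻ r, ∫⁻ ω, v ω r * f ω ^ (p - 1) ∂η ∂ρ := by
          refine lintegral_lintegral_swap (Measurable.aemeasurable ?_)
          exact hv.mul ((hfm.comp measurable_fst).pow_const _)
      _ ≤ ∫⁻ r, (∫⁻ ω, v ω r ^ p ∂η) ^ (1 / p) * I ^ (1 / q) ∂ρ := by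
          refine lintegral_mono fun r => ?_
          have h := ENNReal.lintegral_mul_le_Lp_mul_Lq η hpq
            (f := fun ω => v ω r) (g := fun ω => f ω ^ (p - 1))
            hv.of_uncurry_right.aemeasurable (hfm.pow_const _).aemeasurable
          simp only [← ENNReal.rpow_mul, hpq.sub_one_mul_conj] at h
          exact h
      _ = _ := by
          refine lintegral_mul_const _ ?_
          have : Measurable fun z : S × Ω => v z.2 z.1 ^ p :=
            (hv.comp measurable_swap).pow_const _
          exact this.lintegral_prod_right'.pow_const _
  rcases eq_or_ne I 0 with h0 | h0
  · rw [h0]; exact bot_le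
  have hIq0 : I ^ (1 / q) ≠ 0 := by simp [ENNReal.rpow_eq_zero_iff, h0, hfin.ne]
  have hIqt : I ^ (1 / q) ≠ ⊤ := by simp [ENNReal.rpow_eq_top_iff, h0, hfin.ne]
  have hsplit : I = I ^ (1 / p) * I ^ (1 / q) := by
    rw [← ENNReal.rpow_add _ _ h0 hfin.ne, one_div, one_div, hpq.inv_add_inv_eq_one,
      ENNReal.rpow_one]
  have h1 : I ^ (1 / p) ≤ ∫⁻ r, (∫⁻ ω, v ω r ^ p ∂η) ^ (1 / p) ∂ρ := by
    rw [hsplit] at key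
    nth_rw 2 [← hsplit] at key
    exact (ENNReal.mul_le_mul_iff_left hIq0 hIqt).1 key
  calc I = (I ^ (1 / p)) ^ p := by
        rw [← ENNReal.rpow_mul, one_div_mul_cancel hp0.ne', ENNReal.rpow_one]
    _ ≤ _ := ENNReal.rpow_le_rpow h1 hp0.le

/-- Jensen's inequality for a finite measure. -/
theorem lintegral_rpow_le {S : Type*} [MeasurableSpace S] (ρ : Measure S) {v : S → ℝ≥0∞}
    (hv : AEMeasurable v ρ) {p : ℝ} (hp : 1 ≤ p) :
    (∫⁻ r, v r ∂ρ) ^ p ≤ ρ univ ^ (p - 1) * ∫⁻ r, v r ^ p ∂ρ := by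
  have hp0 : 0 < p := by linarith
  rcases hp.eq_or_lt with rfl | hp1
  · simp
  have hpq := Real.HolderConjugate.conjExponent hp1
  have h := ENNReal.lintegral_mul_le_Lp_mul_Lq ρ hpq hv (aemeasurable_const (b := 1))
  simp only [Pi.mul_apply, mul_one, ENNReal.one_rpow, lintegral_one] at h
  refine (ENNReal.rpow_le_rpow h hp0.le).trans ?_
  rw [ENNReal.mul_rpow_of_nonneg _ _ hp0.le, ← ENNReal.rpow_mul, ← ENNReal.rpow_mul,
    one_div_mul_cancel hp0.ne', ENNReal.rpow_one, mul_comm, one_div_mul_eq_div, hpq.div_conj_eq_sub_one]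

end Minkowski

section Speed

/-- A bound by Bochner integrals of a possibly non-measurable function gives a bound by integrals
of an integrable function on the whole line. -/
theorem IsACOn.exists_integrable {X : Type*} [PseudoMetricSpace X] {T : ℝ} (hT : 0 ≤ T)
    {x : ℝ → X} (hx : IsACOn T x) (hclamp : ∀ r, x ↑(projIcc 0 T hT r) = x r) :
    ∃ g : ℝ → ℝ, Integrable g ∧ (∀ r, 0 ≤ g r) ∧
      ∀ s t, s ≤ t → dist (x s) (x t) ≤ ∫ r in s..t, g r := by
  obtain ⟨g, hg0, hgfin, hg⟩ := hx
  let ν := (volume.restrict (Icc 0 T)).withDensity fun r => ENNReal.ofReal (g r)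
  have hνfin : IsFiniteMeasure ν := isFiniteMeasure_withDensity hgfin.ne
  have hνac : ν ≪ volume :=
    (withDensity_absolutelyContinuous _ _).trans Measure.absolutelyContinuous_restrict
  refine ⟨fun r => (ν.rnDeriv volume r).toReal, Measure.integrable_toReal_rnDeriv,
    fun r => ENNReal.toReal_nonneg, fun s t hst => ?_⟩
  rw [intervalIntegral.integral_of_le hst, Measure.setIntegral_toReal_rnDeriv hνac]
  set s' : ℝ := ↑(projIcc 0 T hT s) with hs'
  set t' : ℝ := ↑(projIcc 0 T hT t) with ht'
  have hs0 : s' ∈ Icc 0 T := (projIcc 0 T hT s).2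
  have ht0 : t' ∈ Icc 0 T := (projIcc 0 T hT t).2
  have hst' : s' ≤ t' := monotone_projIcc hT hst
  have h1 := hg hs0 ht0 hst'
  rw [hs', ht', hclamp, hclamp, ← hs', ← ht'] at h1
  have h2 : ∫ r in Icc s' t', g r ≤ ν.real (Ioc s' t') := by
    by_cases hi : Integrable g (volume.restrict (Icc s' t'))
    · rw [integral_Icc_eq_integral_Ioc, integral_eq_lintegral_of_nonneg_ae
        (ae_of_all _ hg0) (hi.mono_measure
          (Measure.restrict_mono Ioc_subset_Icc_self le_rfl)).aestronglyMeasurable,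
        measureReal_def, withDensity_apply _ measurableSet_Ioc,
        Measure.restrict_restrict measurableSet_Ioc, inter_eq_left.2]
      exact Ioc_subset_Icc_self.trans (Icc_subset_Icc hs0.1 ht0.2)
    · rw [integral_undef hi]
      exact measureReal_nonneg
  refine h1.trans (h2.trans (measureReal_mono ?_))
  intro u hu
  simp only [hs', ht', coe_projIcc, mem_Ioc, max_lt_iff, le_max_iff, le_min_iff] at hu ⊢
  obtain ⟨⟨hu0, hu1⟩, hu2⟩ := hu
  have h3 : u ≤ T ∧ u ≤ t := hu2.resolve_left (by linarith)
  refine ⟨?_, h3.2⟩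
  rcases min_lt_iff.1 hu1 with h | h
  · linarith [h3.1]
  · exact h

/-- A measurable version of the metric derivative: the lower limit of the difference quotients
along the increments `1 / (n + 1)`. -/
def speed {X : Type*} [PseudoEMetricSpace X] (x : ℝ → X) (t : ℝ) : ℝ≥0∞ :=
  liminf (fun n : ℕ => edist (x (t + 1 / (n + 1))) (x t) / ENNReal.ofReal (1 / (n + 1))) atTop

theorem tendsto_add_one_div_nhdsNE (t : ℝ) :
    Tendsto (fun n : ℕ => t + 1 / ((n : ℝ) + 1)) atTop (nhdsWithin t {t}ᶜ) := by
  refine tendsto_nhdsWithin_iff.2 ⟨?_, Eventually.of_forall fun n => ?_⟩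
  · simpa using tendsto_one_div_add_atTop_nhds_zero_nat.const_add t
  · have : (0 : ℝ) < 1 / ((n : ℝ) + 1) := by positivity
    simp only [mem_compl_iff, mem_singleton_iff]
    linarith

theorem speed_eq_of_tendsto {X : Type*} [PseudoMetricSpace X] {x : ℝ → X} {t c : ℝ}
    (h : Tendsto (fun s => dist (x s) (x t) / |s - t|) (nhdsWithin t {t}ᶜ) (nhds c)) :
    speed x t = ENNReal.ofReal c := by
  have h1 := ENNReal.tendsto_ofReal (h.comp (tendsto_add_one_div_nhdsNE t))
  refine Tendsto.liminf_eq (h1.congr fun n => ?_)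
  have h0 : (0 : ℝ) < 1 / ((n : ℝ) + 1) := by positivity
  simp only [Function.comp_apply, add_sub_cancel_left]
  rw [abs_of_pos h0, ENNReal.ofReal_div_of_pos h0, ← edist_dist]

theorem speed_rpow_eq_of_tendsto {X : Type*} [PseudoMetricSpace X] {x : ℝ → X} {t : ℝ} {p : ℝ}
    (hp : 0 ≤ p) (h : ∃ c, Tendsto (fun s => dist (x s) (x t) / |s - t|) (nhdsWithin t {t}ᶜ)
      (nhds c)) : speed x t ^ p = ENNReal.ofReal (mSpeed x t ^ p) := by
  obtain ⟨c, hc⟩ := h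
  have hm : mSpeed x t = c := hc.limUnder_eq
  have hc0 : 0 ≤ c := ge_of_tendsto' hc fun s => by positivity
  rw [speed_eq_of_tendsto hc, hm, ENNReal.ofReal_rpow_of_nonneg hc0 hp]

theorem IsACOn.ae_exists_tendsto_and_edist_le {X : Type*} [PseudoMetricSpace X] {T : ℝ}
    (hT : 0 ≤ T) {x : ℝ → X} (hx : IsACOn T x)
    (hclamp : ∀ r, x ↑(projIcc 0 T hT r) = x r) :
    (∀ᵐ t, ∃ c, Tendsto (fun s => dist (x s) (x t) / |s - t|) (nhdsWithin t {t}ᶜ) (nhds c)) ∧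
      ∀ s t, s ≤ t → edist (x s) (x t) ≤ ∫⁻ r in Icc s t, speed x r := by
  obtain ⟨g, hgi, hg0, hg⟩ := hx.exists_integrable hT hclamp
  obtain ⟨m, hm, hm0, hmi, -, hdm, hlim⟩ := exists_metricDeriv (d := fun s t => dist (x s) (x t))
    (fun s => dist_self _) (fun s t => dist_comm _ _) (fun r s t => dist_triangle _ _ _) hgi hg0 hg
  refine ⟨by filter_upwards [hlim] with t ht using ⟨_, ht⟩, fun s t hst => ?_⟩
  have h1 : ∫⁻ r in Icc s t, speed x r = ∫⁻ r in Icc s t, ENNReal.ofReal (m r) :=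
    lintegral_congr_ae (ae_restrict_of_ae (by
      filter_upwards [hlim] with r hr using speed_eq_of_tendsto hr))
  rw [h1, ← ofReal_integral_eq_lintegral_ofReal hmi.restrict (ae_of_all _ hm0),
    integral_Icc_eq_integral_Ioc, ← intervalIntegral.integral_of_le hst, edist_dist]
  exact ENNReal.ofReal_le_ofReal (hdm s t hst)

theorem tendsto_nhdsNE_zero_iff_rat {F : ℝ → ℝ} (hF : ContinuousOn F {0}ᶜ) (c : ℝ) :
    Tendsto F (nhdsWithin 0 {0}ᶜ) (nhds c) ↔
      Tendsto (fun q : ℚ => F q) (comap ((↑) : ℚ → ℝ) (nhdsWithin 0 {0}ᶜ)) (nhds c) := by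
  refine ⟨fun h => h.comp tendsto_comap, fun h => ?_⟩
  rw [Metric.tendsto_nhds] at h ⊢
  intro ε hε
  have h1 := h (ε / 2) (half_pos hε)
  rw [eventually_comap] at h1
  obtain ⟨δ, hδ, h2⟩ := Metric.mem_nhdsWithin_iff.1 h1
  refine Metric.mem_nhdsWithin_iff.2 ⟨δ, hδ, fun y hy => ?_⟩
  by_contra hcon
  have hopen : IsOpen ({0}ᶜ ∩ F ⁻¹' {u | ε / 2 < dist u c}) :=
    hF.isOpen_inter_preimage isOpen_compl_singleton
      (isOpen_lt continuous_const (continuous_id.dist continuous_const))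
  obtain ⟨q, hq⟩ := (Rat.denseRange_cast (𝕜 := ℝ)).exists_mem_open
    (hopen.inter (Metric.isOpen_ball (x := (0 : ℝ)) (ε := δ)))
    ⟨y, ⟨hy.2, by
      simp only [mem_preimage, mem_ofPred_eq, not_lt] at hcon ⊢
      linarith⟩, hy.1⟩
  have h3 := h2 ⟨hq.2, hq.1.1⟩ q rfl
  have h4 : ε / 2 < dist (F q) c := hq.1.2
  linarith

theorem tendsto_quotient_iff_rat {X : Type*} [PseudoMetricSpace X] {x : ℝ → X}
    (hx : Continuous x) (t c : ℝ) :
    Tendsto (fun s => dist (x s) (x t) / |s - t|) (nhdsWithin t {t}ᶜ) (nhds c) ↔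
      Tendsto (fun q : ℚ => dist (x (t + q)) (x t) / |(q : ℝ)|)
        (comap ((↑) : ℚ → ℝ) (nhdsWithin 0 {0}ᶜ)) (nhds c) := by
  have h := tendsto_nhdsNE_zero_iff_rat (F := fun h => dist (x (t + h)) (x t) / |h|)
    (ContinuousOn.div (by fun_prop) (by fun_prop) fun h hh => by simpa using hh) c
  rw [← h]
  have h0 := map_add_left_nhdsNE (c := t) (a := (0 : ℝ))
  rw [add_zero] at h0
  rw [← h0, tendsto_map'_iff]
  simp only [Function.comp_def, add_sub_cancel_left]

end Speed

section Join

variable {α : Type*} [MeasurableSpace α] {L : Measure (Measure α)}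

theorem ae_join_of_ae_ae {P : α → Prop} (hP : MeasurableSet {a | P a})
    (h : ∀ᵐ μ ∂L, ∀ᵐ a ∂μ, P a) : ∀ᵐ a ∂L.join, P a := by
  have : L.join {a | P a}ᶜ = 0 := by
    rw [Measure.join_apply hP.compl, lintegral_eq_zero_iff (Measure.measurable_coe hP.compl)]
    exact h
  exact this

theorem lintegral_join_mono {f g : α → ℝ≥0∞} (hf : Measurable f) (hg : Measurable g)
    (h : ∀ᵐ μ ∂L, ∀ᵐ a ∂μ, f a ≤ g a) : ∫⁻ a, f a ∂L.join ≤ ∫⁻ a, g a ∂L.join := by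
  rw [Measure.lintegral_join hf.aemeasurable, Measure.lintegral_join hg.aemeasurable]
  exact lintegral_mono_ae (h.mono fun μ hμ => lintegral_mono_ae hμ)

/-- A property which holds almost everywhere in the last variable holds, for almost every value
of the last variable, almost everywhere in the first ones. -/
theorem ae_ae_ae_swap [SFinite L.join] {S : Set (α × ℝ)} (hS : MeasurableSet S)
    (h : ∀ᵐ μ ∂L, ∀ᵐ a ∂μ, ∀ᵐ t, (a, t) ∈ S) : ∀ᵐ t : ℝ, ∀ᵐ μ ∂L, ∀ᵐ a ∂μ, (a, t) ∈ S := by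
  have hm : MeasurableSet {a | ∀ᵐ t, (a, t) ∈ S} :=
    measurable_measure_prodMk_left (ν := (volume : Measure ℝ)) hS.compl (measurableSet_singleton 0)
  have h1 := (Measure.ae_ae_comm (μ := L.join) (ν := volume) (p := fun a t => (a, t) ∈ S) hS).1
    (ae_join_of_ae_ae hm h)
  exact h1.mono fun t ht => Measure.ae_ae_of_ae_join ht

end Join

section Curves

variable {X : Type*} [MetricSpace X] {T : ℝ} (hT : 0 ≤ T)

theorem continuous_extendIcc_uncurry :
    Continuous fun z : C(Icc (0:ℝ) T, X) × ℝ => extendIcc hT z.1 z.2 := by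
  unfold extendIcc
  have : Continuous fun z : C(Icc (0:ℝ) T, X) × ℝ => (z.1, projIcc 0 T hT z.2) :=
    continuous_fst.prodMk (continuous_projIcc.comp continuous_snd)
  exact ContinuousEval.continuous_eval.comp this

theorem extendIcc_projIcc (γ : C(Icc (0:ℝ) T, X)) (r : ℝ) :
    extendIcc hT γ ↑(projIcc 0 T hT r) = extendIcc hT γ r := by
  simp [extendIcc, projIcc_val]

theorem continuous_extendIcc (γ : C(Icc (0:ℝ) T, X)) : Continuous (extendIcc hT γ) :=
  (continuous_extendIcc_uncurry hT).comp (Continuous.prodMk_right γ)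

variable [MeasurableSpace C(Icc (0:ℝ) T, X)] [BorelSpace C(Icc (0:ℝ) T, X)]

theorem measurable_extendIcc [MeasurableSpace X] [BorelSpace X] (t : ℝ) :
    Measurable fun γ : C(Icc (0:ℝ) T, X) => extendIcc hT γ t :=
  ((continuous_extendIcc_uncurry hT).comp (Continuous.prodMk_left t)).measurable

theorem measurable_speed_extendIcc :
    Measurable fun z : C(Icc (0:ℝ) T, X) × ℝ => speed (extendIcc hT z.1) z.2 := by
  unfold speed
  refine Measurable.liminf fun n => Measurable.div_const (Continuous.measurable ?_) _
  have := continuous_extendIcc_uncurry (X := X) hT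
  exact Continuous.edist
    (this.comp (continuous_fst.prodMk (continuous_snd.add continuous_const))) this

theorem measurableSet_exists_tendsto_quotient :
    MeasurableSet {z : C(Icc (0:ℝ) T, X) × ℝ | ∃ c, Tendsto
      (fun s => dist (extendIcc hT z.1 s) (extendIcc hT z.1 z.2) / |s - z.2|)
      (nhdsWithin z.2 {z.2}ᶜ) (nhds c)} := by
  simp_rw [tendsto_quotient_iff_rat (continuous_extendIcc hT _)]
  refine StronglyMeasurable.measurableSet_exists_tendsto fun q => ?_
  refine (Continuous.measurable ?_).stronglyMeasurable
  have := continuous_extendIcc_uncurry (X := X) hT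
  exact Continuous.div_const (Continuous.dist
    (this.comp (continuous_fst.prodMk (continuous_snd.add continuous_const))) this) _

theorem measurable_edist_extendIcc_rpow (p : ℝ) (xb : X) (t : ℝ) :
    Measurable fun γ : C(Icc (0:ℝ) T, X) => edist (extendIcc hT γ t) xb ^ p :=
  (Continuous.measurable (((continuous_extendIcc_uncurry hT).comp
    (Continuous.prodMk_left t)).edist continuous_const)).pow_const p

theorem measurable_speed_extendIcc_rpow (p r : ℝ) :
    Measurable fun γ : C(Icc (0:ℝ) T, X) => speed (extendIcc hT γ) r ^ p :=
  Measurable.of_uncurry_right (f := fun (γ : C(Icc (0:ℝ) T, X)) r => speed (extendIcc hT γ) r ^ p)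
    ((measurable_speed_extendIcc hT).pow_const p)

theorem measurable_setLIntegral_speed_rpow (p : ℝ) (s : Set ℝ) :
    Measurable fun γ : C(Icc (0:ℝ) T, X) => ∫⁻ r in s, speed (extendIcc hT γ) r ^ p :=
  Measurable.lintegral_prod_right' ((measurable_speed_extendIcc hT).pow_const p)

theorem setLIntegral_speed_rpow_le {p : ℝ} (hp : 1 ≤ p) {s t : ℝ} (hs : s ∈ Icc 0 T)
    (ht : t ∈ Icc 0 T)
    (γ : C(Icc (0:ℝ) T, X)) :
    (∫⁻ r in Icc s t, speed (extendIcc hT γ) r) ^ p ≤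
      ENNReal.ofReal T ^ (p - 1) * ∫⁻ r in Icc 0 T, speed (extendIcc hT γ) r ^ p := by
  have hm : Measurable fun r => speed (extendIcc hT γ) r :=
    Measurable.of_uncurry_left (f := fun (γ : C(Icc (0:ℝ) T, X)) r => speed (extendIcc hT γ) r)
      (measurable_speed_extendIcc hT)
  have hsub : Icc s t ⊆ Icc 0 T := Icc_subset_Icc hs.1 ht.2
  refine (lintegral_rpow_le _ hm.aemeasurable hp).trans ?_
  refine mul_le_mul' (ENNReal.rpow_le_rpow ?_ (by linarith)) (lintegral_mono_set hsub)
  rw [Measure.restrict_apply_univ, Real.volume_Icc]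
  exact ENNReal.ofReal_le_ofReal (by linarith [hs.1, ht.2])

end Curves

theorem lintegral_rpow_one_div_rpow {Ω S : Type*} [MeasurableSpace Ω] [MeasurableSpace S]
    {η : Measure Ω} {ρ : Measure S} [SFinite η] [SFinite ρ] {v : Ω → S → ℝ≥0∞}
    (hv : Measurable (Function.uncurry v)) {p : ℝ} (hp : p ≠ 0) :
    ∫⁻ r, ((∫⁻ ω, v ω r ^ p ∂η) ^ (1 / p)) ^ p ∂ρ = ∫⁻ ω, (∫⁻ r, v ω r ^ p ∂ρ) ∂η := by
  simp_rw [← ENNReal.rpow_mul, one_div_mul_cancel hp, ENNReal.rpow_one]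
  exact (lintegral_lintegral_swap (hv.pow_const p).aemeasurable).symm

section Moments

variable {X : Type*} [MetricSpace X] {T p : ℝ} {hT : 0 ≤ T}
  [MeasurableSpace C(Icc (0:ℝ) T, X)] [BorelSpace C(Icc (0:ℝ) T, X)]
  {L : Measure (Measure C(Icc (0:ℝ) T, X))}

theorem lintegral_edist_rpow_lt_top [IsFiniteMeasure L.join] (hp : 1 ≤ p) (xb : X)
    (hle : ∀ᵐ lam ∂L, ∀ᵐ γ ∂lam, ∀ s t, s ≤ t →
      edist (extendIcc hT γ s) (extendIcc hT γ t) ≤ ∫⁻ r in Icc s t, speed (extendIcc hT γ) r)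
    (h0 : ∫⁻ γ, edist (extendIcc hT γ 0) xb ^ p ∂L.join < ⊤)
    (h1 : ∫⁻ γ, (∫⁻ r in Icc 0 T, speed (extendIcc hT γ) r ^ p) ∂L.join < ⊤) (t : ℝ) :
    ∫⁻ γ, edist (extendIcc hT γ t) xb ^ p ∂L.join < ⊤ := by
  have hp0 : 0 ≤ p := by linarith
  have hmE := measurable_edist_extendIcc_rpow (X := X) hT p xb
  have hmI := measurable_setLIntegral_speed_rpow (X := X) hT p (Icc 0 T)
  refine (lintegral_join_mono (hmE t) (g := fun γ => 2 ^ (p - 1) *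
    (edist (extendIcc hT γ 0) xb ^ p + ENNReal.ofReal T ^ (p - 1) *
      ∫⁻ r in Icc 0 T, speed (extendIcc hT γ) r ^ p))
    (by fun_prop) ?_).trans_lt ?_
  · filter_upwards [hle] with lam hlam
    filter_upwards [hlam] with γ hγ
    have ht := (projIcc 0 T hT t).2
    rw [← extendIcc_projIcc hT γ t]
    set t' : ℝ := ↑(projIcc 0 T hT t)
    have h2 : edist (extendIcc hT γ t') xb ≤
        edist (extendIcc hT γ 0) xb + ∫⁻ r in Icc 0 t', speed (extendIcc hT γ) r := by
      refine (edist_triangle_left _ _ (extendIcc hT γ 0)).trans ?_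
      rw [add_comm]
      exact add_le_add le_rfl (hγ 0 t' ht.1)
    refine (ENNReal.rpow_le_rpow h2 hp0).trans
      ((ENNReal.rpow_add_le_mul_rpow_add_rpow _ _ hp).trans ?_)
    gcongr
    exact setLIntegral_speed_rpow_le hT hp ⟨le_rfl, hT⟩ ht γ
  · rw [lintegral_const_mul _ (by fun_prop), lintegral_add_left (hmE 0),
      lintegral_const_mul _ hmI]
    refine ENNReal.mul_lt_top (ENNReal.rpow_lt_top_of_nonneg (by linarith) (by simp))
      (ENNReal.add_lt_top.2 ⟨h0, ENNReal.mul_lt_top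
        (ENNReal.rpow_lt_top_of_nonneg (by linarith) (by simp)) h1⟩)

variable [MeasurableSpace X] [BorelSpace X]

/-- The random measure at time `t`. -/
def evalLaw (hT : 0 ≤ T) (L : Measure (Measure C(Icc (0:ℝ) T, X))) (t : ℝ) : Measure (Measure X) :=
  L.map fun lam => lam.map fun γ => extendIcc hT γ t

theorem ae_evalLaw_hasMoment [TopologicalSpace.SeparableSpace X]
    (hprob : ∀ᵐ lam ∂L, IsProbabilityMeasure lam) (xb : X) {t : ℝ}
    (h : ∫⁻ γ, edist (extendIcc hT γ t) xb ^ p ∂L.join < ⊤) :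
    ∀ᵐ μ ∂evalLaw hT L t, HasMoment p xb μ := by
  have hm := measurable_extendIcc (X := X) hT t
  have hmd : Measurable fun x : X => edist x xb ^ p :=
    (continuous_id.edist continuous_const).measurable.pow_const p
  rw [evalLaw, ae_map_iff (Measure.measurable_map _ hm).aemeasurable
    (measurableSet_hasMoment p xb)]
  rw [Measure.lintegral_join (measurable_edist_extendIcc_rpow hT p xb t).aemeasurable] at h
  filter_upwards [hprob,
    ae_lt_top (Measure.measurable_lintegral (measurable_edist_extendIcc_rpow hT p xb t)) h.ne]
    with lam h1 h2
  exact ⟨Measure.isProbabilityMeasure_map hm.aemeasurable, by rwa [lintegral_map hmd hm]⟩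

theorem lintegral_Wpp_evalLaw_dirac_le (hprob : ∀ᵐ lam ∂L, IsProbabilityMeasure lam) (xb : X)
    (t : ℝ) : ∫⁻ μ, Wpp p μ (Measure.dirac xb) ∂evalLaw hT L t ≤
      ∫⁻ γ, edist (extendIcc hT γ t) xb ^ p ∂L.join := by
  have hm := measurable_extendIcc (X := X) hT t
  rw [Measure.lintegral_join (measurable_edist_extendIcc_rpow hT p xb t).aemeasurable]
  refine (lintegral_map_le _ _).trans (lintegral_mono_ae ?_)
  filter_upwards [hprob] with lam hlam
  have h := otCost_map_le (fun a b : X => edist a b ^ p) lam hm (measurable_const (a := xb))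
  rwa [Measure.map_const, measure_univ, one_smul] at h

theorem WWpp_evalLaw_le (hle : ∀ᵐ lam ∂L, ∀ᵐ γ ∂lam, ∀ s t, s ≤ t →
      edist (extendIcc hT γ s) (extendIcc hT γ t) ≤ ∫⁻ r in Icc s t, speed (extendIcc hT γ) r)
    [IsFiniteMeasure L.join] (hp : 1 ≤ p)
    (h1 : ∫⁻ γ, (∫⁻ r in Icc 0 T, speed (extendIcc hT γ) r ^ p) ∂L.join < ⊤)
    {s t : ℝ} (hs : s ∈ Icc 0 T) (ht : t ∈ Icc 0 T) (hst : s ≤ t) :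
    WWpp p (evalLaw hT L s) (evalLaw hT L t) ≤
      (∫⁻ r in Icc s t, (∫⁻ γ, speed (extendIcc hT γ) r ^ p ∂L.join) ^ (1 / p)) ^ p := by
  have hp0 : 0 ≤ p := by linarith
  have hms := measurable_extendIcc (X := X) hT s
  have hmt := measurable_extendIcc (X := X) hT t
  have hmI : Measurable fun γ : C(Icc (0:ℝ) T, X) => ∫⁻ r in Icc s t, speed (extendIcc hT γ) r := by
    simpa using measurable_setLIntegral_speed_rpow (X := X) hT 1 (Icc s t)
  have h2 : WWpp p (evalLaw hT L s) (evalLaw hT L t) ≤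
      ∫⁻ γ, (∫⁻ r in Icc s t, speed (extendIcc hT γ) r) ^ p ∂L.join := by
    rw [Measure.lintegral_join (hmI.pow_const p).aemeasurable]
    refine (otCost_map_le (Wpp p) L (Measure.measurable_map _ hms)
      (Measure.measurable_map _ hmt)).trans (lintegral_mono_ae ?_)
    filter_upwards [hle] with lam hlam
    refine (otCost_map_le (fun a b : X => edist a b ^ p) lam hms hmt).trans
      (lintegral_mono_ae ?_)
    filter_upwards [hlam] with γ hγ
    exact ENNReal.rpow_le_rpow (hγ s t hst) hp0
  refine h2.trans (lintegral_lintegral_rpow_le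
    (v := fun (γ : C(Icc (0:ℝ) T, X)) r => speed (extendIcc hT γ) r)
    (measurable_speed_extendIcc hT) hp ?_)
  refine (lintegral_mono fun γ => setLIntegral_speed_rpow_le hT hp hs ht γ).trans_lt ?_
  rw [lintegral_const_mul _ (measurable_setLIntegral_speed_rpow hT p _)]
  exact ENNReal.mul_lt_top (ENNReal.rpow_lt_top_of_nonneg (by linarith) (by simp)) h1

end Moments

section MetricDerivative

variable {X : Type*} [MetricSpace X] [CompleteSpace X] [TopologicalSpace.SeparableSpace X]
  [MeasurableSpace X] [BorelSpace X]

theorem ae_pSpeedWW_le {T p : ℝ} (hT : 0 ≤ T) (hp : 1 ≤ p) (xb : X)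
    {M : ℝ → Measure (Measure X)} (hfin : ∀ t, IsFiniteMeasure (M t))
    (hM : ∀ t, ∀ᵐ μ ∂M t, HasMoment p xb μ) (hclamp : ∀ r, M ↑(projIcc 0 T hT r) = M r)
    {G : ℝ → ℝ≥0∞} (hG : Measurable G) (hGfin : ∫⁻ r in Icc 0 T, G r ^ p < ⊤)
    (hMG : ∀ ⦃s t : ℝ⦄, s ∈ Icc 0 T → t ∈ Icc 0 T → s ≤ t →
      WWpp p (M s) (M t) ≤ (∫⁻ r in Icc s t, G r) ^ p) :
    ∀ᵐ t, pSpeedWW p M t ≤ G t ^ p := by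
  have hp0 : 0 < p := by linarith
  have hp1 : 0 ≤ 1 / p := by positivity
  set G₀ := (Icc 0 T).indicator G with hG₀
  have hG₀m : Measurable G₀ := hG.indicator measurableSet_Icc
  have hG₀fin : ∫⁻ r, G₀ r < ⊤ := by
    rw [hG₀, lintegral_indicator measurableSet_Icc, ← ENNReal.rpow_lt_top_iff_of_pos hp0]
    refine (lintegral_rpow_le _ hG.aemeasurable hp).trans_lt
      (ENNReal.mul_lt_top (ENNReal.rpow_lt_top_of_nonneg (by linarith) ?_) hGfin)
    simp
  have hroot : ∀ s t, s ≤ t → WWpp p (M s) (M t) ^ (1 / p) ≤ ∫⁻ r in Ioc s t, G₀ r := by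
    intro s t hst
    rw [← hclamp s, ← hclamp t, hG₀, lintegral_indicator measurableSet_Icc,
      Measure.restrict_restrict measurableSet_Icc]
    have h1 := ENNReal.rpow_le_rpow (hMG (projIcc 0 T hT s).2 (projIcc 0 T hT t).2
      (monotone_projIcc hT hst)) hp1
    rw [← ENNReal.rpow_mul, mul_one_div_cancel hp0.ne', ENNReal.rpow_one,
      setLIntegral_congr Ioc_ae_eq_Icc.symm] at h1
    refine h1.trans (lintegral_mono_set fun u hu => ?_)
    simp only [coe_projIcc, mem_Ioc, max_lt_iff, le_max_iff, le_min_iff, mem_inter_iff,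
      mem_Icc] at hu ⊢
    obtain ⟨⟨hu0, hu1⟩, hu2⟩ := hu
    have h3 : u ≤ T ∧ u ≤ t := hu2.resolve_left (by linarith)
    refine ⟨⟨hu0.le, h3.1⟩, ?_, h3.2⟩
    rcases min_lt_iff.1 hu1 with h | h
    · linarith [h3.1]
    · exact h
  have hIoc : ∀ s t, ∫⁻ r in Ioc s t, G₀ r ≠ ⊤ := fun s t =>
    ((setLIntegral_le_lintegral _ _).trans_lt hG₀fin).ne
  have hne : ∀ s t, WWpp p (M s) (M t) ^ (1 / p) ≠ ⊤ := by
    intro s t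
    rcases le_total s t with h | h
    · exact ne_top_of_le_ne_top (hIoc s t) (hroot s t h)
    · rw [WWpp_comm]
      exact ne_top_of_le_ne_top (hIoc t s) (hroot t s h)
  obtain ⟨m, -, hm0, -, hmg, -, hlim⟩ := exists_metricDeriv
    (d := fun s t => (WWpp p (M s) (M t) ^ (1 / p)).toReal) (g := fun r => (G₀ r).toReal)
    (fun s => by
      have h := hroot s s le_rfl
      simp only [Ioc_self, Measure.restrict_empty, lintegral_zero_measure, nonpos_iff_eq_zero] at h
      simp only [h, ENNReal.toReal_zero])
    (fun s t => by simp only [WWpp_comm p (M s) (M t)])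
    (fun r s t => by
      have := hfin
      rw [← ENNReal.toReal_add (hne _ _) (hne _ _)]
      exact ENNReal.toReal_mono (ENNReal.add_ne_top.2 ⟨hne _ _, hne _ _⟩)
        (WWpp_triangle hp xb (hM _) (hM _) (hM _)))
    (integrable_toReal_of_lintegral_ne_top hG₀m.aemeasurable hG₀fin.ne)
    (fun r => ENNReal.toReal_nonneg)
    (fun s t hst => by
      rw [intervalIntegral.integral_of_le hst, integral_toReal hG₀m.aemeasurable
        (ae_restrict_of_ae (ae_lt_top hG₀m hG₀fin.ne))]
      exact ENNReal.toReal_mono (hIoc s t) (hroot s t hst))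
  filter_upwards [hmg, hlim] with t ht hlt
  have h1 : Tendsto (fun s => WWpp p (M s) (M t) / ENNReal.ofReal (|s - t| ^ p))
      (nhdsWithin t {t}ᶜ) (nhds (ENNReal.ofReal (m t ^ p))) := by
    refine (ENNReal.tendsto_ofReal (hlt.rpow_const (Or.inr hp0.le))).congr' ?_
    filter_upwards [self_mem_nhdsWithin] with s hs
    have hs' : 0 < |s - t| := abs_pos.2 (sub_ne_zero.2 hs)
    rw [Real.div_rpow ENNReal.toReal_nonneg hs'.le,
      ENNReal.ofReal_div_of_pos (Real.rpow_pos_of_pos hs' p), ENNReal.toReal_rpow,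
      ← ENNReal.rpow_mul, one_div_mul_cancel hp0.ne', ENNReal.rpow_one, ENNReal.ofReal_toReal]
    have := hne s t
    rwa [Ne, ENNReal.rpow_eq_top_iff_of_pos (by positivity)] at this
  rw [pSpeedWW, h1.limUnder_eq, ← ENNReal.ofReal_rpow_of_nonneg (hm0 t) hp0.le]
  refine ENNReal.rpow_le_rpow ?_ hp0.le
  exact (ENNReal.ofReal_le_ofReal ht).trans
    (ENNReal.ofReal_toReal_le.trans (indicator_le_self _ _ _))

end MetricDerivative

/-- Let `(X,d)` be complete separable, `p ≥ 1`, `x̄ ∈ X`, and let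
`𝔏 ∈ P(P(C([0,T],X)))` satisfy `∫∫ (d^p(x̄,γ(0)) + ∫₀ᵀ|γ̇|^p) dλ d𝔏 < ∞`, each inner `λ`
being concentrated on absolutely continuous curves.  Define `M_t := (E_t)_♯𝔏` with
`E_t(λ) = (e_t)_♯λ`.  Then `M = (M_t)` belongs to `AC^p([0,T], P_p(P_p(X)))` for the
Wasserstein-on-Wasserstein metric `𝒲_p = W_{p,W_p}`, and for a.e. `t`,
`|Ṁ|^p(t) ≤ ∫∫ |γ̇|^p(t) dλ d𝔏`. -/
theorem nested_pushforward_curve_ACp_and_speed_bound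
    {X : Type*} [MetricSpace X] [CompleteSpace X] [TopologicalSpace.SeparableSpace X]
    [MeasurableSpace X] [BorelSpace X]
    (T p : ℝ) (hT : 0 < T) (hp : 1 ≤ p) (xb : X)
    [MeasurableSpace C(Icc (0:ℝ) T, X)] [BorelSpace C(Icc (0:ℝ) T, X)]
    (𝔏 : Measure (Measure C(Icc (0:ℝ) T, X))) [IsProbabilityMeasure 𝔏]
    (hprob : ∀ᵐ lam ∂𝔏, IsProbabilityMeasure lam)
    (hAC : ∀ᵐ lam ∂𝔏, ∀ᵐ γ ∂lam, IsACOn T (extendIcc hT.le γ))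
    (hen : ∫⁻ lam, (∫⁻ γ, (edist (extendIcc hT.le γ 0) xb ^ p +
        ∫⁻ r in Icc (0:ℝ) T, ENNReal.ofReal (mSpeed (extendIcc hT.le γ) r ^ p)) ∂lam)
        ∂𝔏 < ⊤) :
    ((∀ t ∈ Icc (0:ℝ) T,
        ∫⁻ μ, Wpp p μ (Measure.dirac xb)
          ∂(𝔏.map (fun lam => lam.map (fun γ => extendIcc hT.le γ t))) < ⊤) ∧
      (∃ G : ℝ → ℝ≥0∞, (∫⁻ r in Icc (0:ℝ) T, G r ^ p) < ⊤ ∧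
        ∀ ⦃s t : ℝ⦄, s ∈ Icc (0:ℝ) T → t ∈ Icc (0:ℝ) T → s ≤ t →
          WWpp p (𝔏.map (fun lam => lam.map (fun γ => extendIcc hT.le γ s)))
              (𝔏.map (fun lam => lam.map (fun γ => extendIcc hT.le γ t)))
            ≤ (∫⁻ r in Icc s t, G r) ^ p)) ∧
    (∀ᵐ t ∂(volume.restrict (Icc (0:ℝ) T)),
      pSpeedWW p (fun s => 𝔏.map (fun lam => lam.map (fun γ => extendIcc hT.le γ s))) t ≤
        ∫⁻ lam, (∫⁻ γ, ENNReal.ofReal (mSpeed (extendIcc hT.le γ) t ^ p) ∂lam) ∂𝔏) := by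
  have hp0 : 0 < p := by linarith
  have hjoin : IsProbabilityMeasure 𝔏.join := isProbabilityMeasure_join hprob
  have hcurve : ∀ᵐ lam ∂𝔏, ∀ᵐ γ ∂lam, _ := hAC.mono fun lam hlam => hlam.mono fun γ hγ =>
    hγ.ae_exists_tendsto_and_edist_le hT.le (extendIcc_projIcc hT.le γ)
  have hle : ∀ᵐ lam ∂𝔏, ∀ᵐ γ ∂lam, ∀ s t, s ≤ t → edist (extendIcc hT.le γ s)
      (extendIcc hT.le γ t) ≤ ∫⁻ r in Icc s t, speed (extendIcc hT.le γ) r :=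
    hcurve.mono fun lam hlam => hlam.mono fun γ hγ => hγ.2
  have hlim := hcurve.mono fun lam hlam => hlam.mono fun γ hγ => hγ.1
  have hspeed : ∀ᵐ t, ∫⁻ lam, (∫⁻ γ, ENNReal.ofReal (mSpeed (extendIcc hT.le γ) t ^ p) ∂lam) ∂𝔏 =
      ∫⁻ γ, speed (extendIcc hT.le γ) t ^ p ∂𝔏.join := by
    filter_upwards [ae_ae_ae_swap (measurableSet_exists_tendsto_quotient hT.le) hlim] with t ht
    rw [Measure.lintegral_join (measurable_speed_extendIcc_rpow hT.le p t).aemeasurable]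
    refine lintegral_congr_ae (ht.mono fun lam hlam => lintegral_congr_ae (hlam.mono fun γ hγ => ?_))
    exact (speed_rpow_eq_of_tendsto hp0.le hγ).symm
  have hmE := measurable_edist_extendIcc_rpow (X := X) hT.le p xb 0
  have hmI := measurable_setLIntegral_speed_rpow (X := X) hT.le p (Icc 0 T)
  have henergy : ∫⁻ γ, (edist (extendIcc hT.le γ 0) xb ^ p +
      ∫⁻ r in Icc 0 T, speed (extendIcc hT.le γ) r ^ p) ∂𝔏.join < ⊤ := by
    rw [Measure.lintegral_join (by fun_prop)]
    refine lt_of_eq_of_lt (lintegral_congr_ae (hlim.mono fun lam hlam =>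
      lintegral_congr_ae (hlam.mono fun γ hγ => ?_))) hen
    exact congrArg (_ + ·) (lintegral_congr_ae (ae_restrict_of_ae (hγ.mono fun r hr =>
      speed_rpow_eq_of_tendsto hp0.le hr)))
  rw [lintegral_add_left hmE, ENNReal.add_lt_top] at henergy
  obtain ⟨h0, h1⟩ := henergy
  set G : ℝ → ℝ≥0∞ := fun r => (∫⁻ γ, speed (extendIcc hT.le γ) r ^ p ∂𝔏.join) ^ (1 / p) with hG
  have hGm : Measurable G := Measurable.pow_const (Measurable.lintegral_prod_left'
    ((measurable_speed_extendIcc hT.le).pow_const p)) _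
  have hGp : ∀ r, G r ^ p = ∫⁻ γ, speed (extendIcc hT.le γ) r ^ p ∂𝔏.join := fun r => by
    rw [hG, ← ENNReal.rpow_mul, one_div_mul_cancel hp0.ne', ENNReal.rpow_one]
  have hGfin : ∫⁻ r in Icc 0 T, G r ^ p < ⊤ := by
    rw [lintegral_rpow_one_div_rpow (measurable_speed_extendIcc hT.le) hp0.ne']
    exact h1
  have hmoment := lintegral_edist_rpow_lt_top hp xb hle h0 h1
  have hWW := fun s t hs ht => WWpp_evalLaw_le (s := s) (t := t) hle hp h1 hs ht
  refine ⟨⟨fun t _ => (lintegral_Wpp_evalLaw_dirac_le hprob xb t).trans_lt (hmoment t),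
    G, hGfin, hWW⟩, ?_⟩
  have hderiv := ae_pSpeedWW_le hT.le hp xb (M := evalLaw hT.le 𝔏)
    (fun t => by unfold evalLaw; infer_instance) (fun t => ae_evalLaw_hasMoment hprob xb (hmoment t))
    (fun r => by simp only [evalLaw, extendIcc_projIcc]) hGm hGfin hWW
  refine ae_restrict_of_ae ?_
  filter_upwards [hderiv, hspeed] with t ht hst
  rw [hst, ← hGp]
  exact ht

end
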